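/- arXiv:1703.00606 — 3 statements merged into one kernel-verified Lean document; each statement's English description precedes it below -/
import Mathlib

section
/- Let G be a P6-free, diamond-free and K4-free graph containing an induced bull with vertices v1, v2, v3, v4, v5 and edges v1v2, v2v3, v3v4, v2v5, v3v5. Then there cannot exist both a vertex x outside the bull whose only neighbor among {v1,...,v5} is v1, and a vertex y outside the bull whose only neighbor among {v1,...,v5} is v4. -/
open SimpleGraph

/-- The disjoint union `P2 ∪ P3`, on 5 vertices: edges 01, 23, 34. -/
def p2p3 : SimpleGraph (Fin 5) :=
  SimpleGraph.fromEdgeSet {s(0, 1), s(2, 3), s(3, 4)}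

/-- The diamond: `K4` minus the edge 02. -/
def diamond : SimpleGraph (Fin 4) :=
  SimpleGraph.fromEdgeSet {s(0, 1), s(1, 2), s(2, 3), s(0, 3), s(1, 3)}

/-- The bull: vertices v1,...,v5 are 0,...,4; edges v1v2, v2v3, v3v4, v2v5, v3v5. -/
def bull : SimpleGraph (Fin 5) :=
  SimpleGraph.fromEdgeSet {s(0, 1), s(1, 2), s(2, 3), s(1, 4), s(2, 4)}

/-- `K4`, the complete graph on 4 vertices. -/
def K4 : SimpleGraph (Fin 4) := ⊤

/-- `G` contains no induced subgraph isomorphic to `H`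
(graph embeddings are exactly induced copies). -/
def IndFree {α β : Type*} (H : SimpleGraph α) (G : SimpleGraph β) : Prop :=
  ¬ Nonempty (H ↪g G)

/-- A map that preserves and reflects adjacency from the path on six vertices yields an
induced copy: injectivity is automatic, since distinct vertices have distinct neighbourhoods. -/
theorem not_indFree_pathGraph_six {V : Type*} {G : SimpleGraph V} (p : Fin 6 → V)
    (h : ∀ i j, G.Adj (p i) (p j) ↔ (pathGraph 6).Adj i j) : ¬ IndFree (pathGraph 6) G := by
  have separated : ∀ i j : Fin 6,
      (∀ k, (pathGraph 6).Adj i k ↔ (pathGraph 6).Adj j k) → i = j := by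
    simp only [pathGraph_adj]
    decide
  refine not_not_intro ⟨⟨⟨p, fun i j hij => separated i j fun k => ?_⟩, h _ _⟩⟩
  rw [← h, ← h, hij]

/-- In a (P6, diamond, K4)-free graph with an induced bull (vertices
f 0,...,f 4 where f 0 = v1 and f 3 = v4 are the pendant vertices), there
cannot be both an outside vertex attached exactly to v1 and an outside vertex
attached exactly to v4. -/
theorem stmt16 {V : Type*} [Fintype V] (G : SimpleGraph V)
    (hP : IndFree (pathGraph 6) G) (hD : IndFree diamond G) (hK : IndFree K4 G)
    (f : bull ↪g G) :
    ¬ ((∃ x : V, (∀ i : Fin 5, x ≠ f i) ∧ G.Adj x (f 0) ∧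
          ∀ i : Fin 5, i ≠ 0 → ¬ G.Adj x (f i)) ∧
       (∃ y : V, (∀ i : Fin 5, y ≠ f i) ∧ G.Adj y (f 3) ∧
          ∀ i : Fin 5, i ≠ 3 → ¬ G.Adj y (f i))) := by
  rintro ⟨⟨x, -, hx, hx'⟩, ⟨y, -, hy, hy'⟩⟩
  have hf : ∀ i j, G.Adj (f i) (f j) ↔
      s(i, j) ∈ ({s(0, 1), s(1, 2), s(2, 3), s(1, 4), s(2, 4)} : Set (Sym2 (Fin 5))) ∧ i ≠ j :=
    fun _ _ => f.map_adj_iff.trans (fromEdgeSet_adj _)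
  have hxf : ∀ i, G.Adj x (f i) ↔ i = 0 := fun i =>
    ⟨fun h => by_contra fun hi => hx' i hi h, fun h => h ▸ hx⟩
  have hyf : ∀ i, G.Adj y (f i) ↔ i = 3 := fun i =>
    ⟨fun h => by_contra fun hi => hy' i hi h, fun h => h ▸ hy⟩
  have hfx : ∀ i, G.Adj (f i) x ↔ i = 0 := fun i => (G.adj_comm _ _).trans (hxf i)
  have hfy : ∀ i, G.Adj (f i) y ↔ i = 3 := fun i => (G.adj_comm _ _).trans (hyf i)
  by_cases hxy : G.Adj x y
  · refine not_indFree_pathGraph_six ![f 0, x, y, f 3, f 2, f 4] (fun i j => ?_) hP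
    fin_cases i <;> fin_cases j <;>
      simp [pathGraph_adj, hf, hxf, hyf, hfx, hfy, hxy, hxy.symm]
  · have hyx : ¬ G.Adj y x := fun h => hxy h.symm
    refine not_indFree_pathGraph_six ![x, f 0, f 1, f 2, f 3, y] (fun i j => ?_) hP
    fin_cases i <;> fin_cases j <;>
      simp [pathGraph_adj, hf, hxf, hyf, hfx, hfy, hxy, hyx]
end

section
/- Let G be a connected graph that is P6-free, diamond-free and K4-free, and suppose G contains an induced bull B. Then every vertex of G is at distance at most 2 from B; that is, for every vertex y of G there is a vertex of B at graph distance at most 2 from y. -/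
open SimpleGraph

/-- A map reflecting and preserving adjacency, out of a graph whose vertices are separated by their
neighbourhoods, is an induced copy. -/
theorem IndFree.false_of_adj_iff {α β : Type*} {H : SimpleGraph α} {G : SimpleGraph β}
    (h : IndFree H G) (hH : ∀ i j, (∀ k, H.Adj i k ↔ H.Adj j k) → i = j) (f : α → β)
    (hf : ∀ i j, G.Adj (f i) (f j) ↔ H.Adj i j) : False := by
  refine h ⟨⟨⟨f, fun i j hij => hH i j fun k => ?_⟩, hf _ _⟩⟩
  rw [← hf, ← hf, hij]

theorem IndFree.false_of_path6 {V : Type*} {G : SimpleGraph V} (h : IndFree (pathGraph 6) G)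
    {a b c d e f : V} (hab : G.Adj a b) (hbc : G.Adj b c) (hcd : G.Adj c d) (hde : G.Adj d e)
    (hef : G.Adj e f) (hac : ¬ G.Adj a c) (had : ¬ G.Adj a d) (hae : ¬ G.Adj a e)
    (haf : ¬ G.Adj a f) (hbd : ¬ G.Adj b d) (hbe : ¬ G.Adj b e) (hbf : ¬ G.Adj b f)
    (hce : ¬ G.Adj c e) (hcf : ¬ G.Adj c f) (hdf : ¬ G.Adj d f) : False := by
  refine h.false_of_adj_iff ?_ ![a, b, c, d, e, f] ?_
  · simp only [pathGraph_adj]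
    decide
  · intro i j
    fin_cases i <;> fin_cases j <;> simp [pathGraph_adj, G.adj_comm, *]

/-- In a diamond-free and `K4`-free graph, a vertex off a triangle has at most one neighbour
on it. -/
theorem not_adj_of_triangle {V : Type*} {G : SimpleGraph V} (hD : IndFree diamond G)
    (hK : IndFree K4 G) {x a b c : V} (hab : G.Adj a b) (hac : G.Adj a c) (hbc : G.Adj b c)
    (hxc : x ≠ c) (hxa : G.Adj x a) : ¬ G.Adj x b := by
  intro hxb
  by_cases h : G.Adj x c
  · refine hK ⟨⟨⟨![x, a, b, c], ?_⟩, ?_⟩⟩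
    · intro i j
      fin_cases i <;> fin_cases j <;>
        simp [hab.ne, hac.ne, hbc.ne, hxa.ne, hxb.ne, h.ne,
          hab.ne', hac.ne', hbc.ne', hxa.ne', hxb.ne', h.ne']
    · intro i j
      change G.Adj (![x, a, b, c] i) (![x, a, b, c] j) ↔ _
      fin_cases i <;> fin_cases j <;> simp [K4, *, hab.symm, hac.symm, hbc.symm, hxa.symm,
        hxb.symm, h.symm]
  · have h' : ¬ G.Adj c x := fun h' => h h'.symm
    refine hD ⟨⟨⟨![x, a, c, b], ?_⟩, ?_⟩⟩
    · intro i j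
      fin_cases i <;> fin_cases j <;>
        simp [hab.ne, hac.ne, hbc.ne, hxa.ne, hxb.ne, hxc,
          hab.ne', hac.ne', hbc.ne', hxa.ne', hxb.ne', hxc.symm]
    · intro i j
      change G.Adj (![x, a, c, b] i) (![x, a, c, b] j) ↔ _
      fin_cases i <;> fin_cases j <;> simp [diamond, *, hab.symm, hac.symm, hbc.symm, hxa.symm,
        hxb.symm]

/-- In a `(P6, diamond, K4)`-free graph, a path `x, y, z` cannot approach an induced bull in such a
way that only `z` has a neighbour in the bull. -/
theorem not_adj_bull {V : Type*} {G : SimpleGraph V} (hP : IndFree (pathGraph 6) G)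
    (hD : IndFree diamond G) (hK : IndFree K4 G) (f : bull ↪g G) {x y z : V} (hxy : G.Adj x y)
    (hyz : G.Adj y z) (hxz : ¬ G.Adj x z) (hx : ∀ i, ¬ G.Adj x (f i))
    (hy : ∀ i, ¬ G.Adj y (f i)) (i : Fin 5) : ¬ G.Adj z (f i) := by
  have h01 : G.Adj (f 0) (f 1) := f.map_rel_iff.2 (by simp [bull])
  have h12 : G.Adj (f 1) (f 2) := f.map_rel_iff.2 (by simp [bull])
  have h23 : G.Adj (f 2) (f 3) := f.map_rel_iff.2 (by simp [bull])
  have h14 : G.Adj (f 1) (f 4) := f.map_rel_iff.2 (by simp [bull])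
  have h24 : G.Adj (f 2) (f 4) := f.map_rel_iff.2 (by simp [bull])
  have n02 : ¬ G.Adj (f 0) (f 2) := fun h => absurd (f.map_rel_iff.1 h) (by simp [bull])
  have n03 : ¬ G.Adj (f 0) (f 3) := fun h => absurd (f.map_rel_iff.1 h) (by simp [bull])
  have n04 : ¬ G.Adj (f 0) (f 4) := fun h => absurd (f.map_rel_iff.1 h) (by simp [bull])
  have n13 : ¬ G.Adj (f 1) (f 3) := fun h => absurd (f.map_rel_iff.1 h) (by simp [bull])
  have n34 : ¬ G.Adj (f 3) (f 4) := fun h => absurd (f.map_rel_iff.1 h) (by simp [bull])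
  have hz : ∀ j, z ≠ f j := fun j h => hy j (h ▸ hyz)
  have t12 := not_adj_of_triangle (x := z) hD hK h12 h14 h24 (hz 4)
  have t14 := not_adj_of_triangle (x := z) hD hK h14 h12 h24.symm (hz 2)
  have t24 := not_adj_of_triangle (x := z) hD hK h24 h12.symm h14.symm (hz 1)
  have key : ∀ i j k, G.Adj (f i) (f j) → G.Adj (f j) (f k) → ¬ G.Adj (f i) (f k) →
      G.Adj z (f i) → ¬ G.Adj z (f j) → ¬ G.Adj z (f k) → False :=
    fun i j k hij hjk hik hi hj hk =>
      hP.false_of_path6 hxy hyz hi hij hjk hxz (hx i) (hx j) (hx k) (hy i) (hy j) (hy k) hj hk hik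
  have k012 := key 0 1 2 h01 h12 n02
  have k014 := key 0 1 4 h01 h14 n04
  have k321 := key 3 2 1 h23.symm h12.symm fun h => n13 h.symm
  have k324 := key 3 2 4 h23.symm h24 n34
  have k123 := key 1 2 3 h12 h23 n13
  have k210 := key 2 1 0 h12.symm h01.symm fun h => n02 h.symm
  have k410 := key 4 1 0 h14.symm h01.symm fun h => n04 h.symm
  have n1 : ¬ G.Adj z (f 1) := fun h => k324 (by_contra (k123 h (t12 h))) (t12 h) (t14 h)
  have n2 : ¬ G.Adj z (f 2) := fun h => k014 (by_contra (k210 h n1)) n1 (t24 h)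
  have n0 : ¬ G.Adj z (f 0) := fun h => k012 h n1 n2
  have n3 : ¬ G.Adj z (f 3) := fun h => k321 h n2 n1
  have n4 : ¬ G.Adj z (f 4) := fun h => k410 h n1 n0
  fin_cases i
  exacts [n0, n1, n2, n3, n4]

/-- In a connected (P6, diamond, K4)-free graph containing an induced bull,
every vertex is at distance at most 2 from the bull. -/
theorem stmt17 {V : Type*} [Fintype V] (G : SimpleGraph V)
    (hconn : G.Connected)
    (hP : IndFree (pathGraph 6) G) (hD : IndFree diamond G) (hK : IndFree K4 G)
    (f : bull ↪g G) :
    ∀ y : V, ∃ i : Fin 5, G.dist y (f i) ≤ 2 := by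
  intro y
  by_contra hfar
  obtain ⟨p⟩ := hconn.preconnected y (f 0)
  obtain ⟨⟨⟨x, y⟩, hxy⟩, -, hx, hy⟩ :=
    p.exists_boundary_dart {v | ¬ ∃ i, G.dist v (f i) ≤ 2} hfar
      (fun h => h ⟨0, by simp⟩)
  simp only [Set.mem_ofPred_eq, not_exists, not_le, not_forall, not_lt] at hx hy hxy
  have hlong : ∀ i (q : G.Walk x (f i)), 2 < q.length := fun i q =>
    (hx i).trans_le (dist_le q)
  obtain ⟨i, hi⟩ := hy
  obtain ⟨q, hq⟩ := hconn.exists_walk_length_eq_dist y (f i)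
  have hxq := hlong i (q.cons hxy)
  rw [Walk.length_cons] at hxq
  obtain ⟨z, hz⟩ := G.walkLengthTwoEquivCommonNeighbors y (f i) ⟨q, by omega⟩
  obtain ⟨hyz, hiz⟩ := G.mem_commonNeighbors.1 hz
  refine not_adj_bull hP hD hK f hxy hyz (fun h => ?_) (fun j h => ?_) (fun j h => ?_) i hiz.symm
  · simpa using hlong i (.cons h hiz.symm.toWalk)
  · simpa using hlong j h.toWalk
  · simpa using hlong j (.cons hxy h.toWalk)
end

section
/- There exists a finite graph G that is (P2 ∪ P3)-free, diamond-free and K4-free with chromatic number exactly 6 (for instance, the complement of the 16-regular Schläfli graph on 27 vertices). In particular, there exists a P6-free, diamond-free, K4-free graph with chromatic number exactly 6, so the bound 6 in the main theorem is tight. -/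
open SimpleGraph

/-- All ways to add the vertex `v`, whose set of non-neighbours is `m`, to one of the colour classes.
A class is represented by the bit set of the vertices that may still belong to it. -/
def insertions (v m : ℕ) : List ℕ → List (List ℕ)
  | [] => []
  | c :: cs => bif c.testBit v then ((c &&& m) :: cs) :: (insertions v m cs).map (c :: ·)
      else (insertions v m cs).map (c :: ·)

/-- Backtracking search for a colouring with at most `k` classes, given the bit sets `N v` of
non-neighbours. The vertex to branch on is chosen by `sel` from the bit set `U` of uncoloured
vertices and the current classes. A result `false` certifies that no colouring exists. -/
def colorSearch {n : ℕ} (N : Fin n → ℕ) (sel : ℕ → List ℕ → Fin n) (k : ℕ) :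
    ℕ → ℕ → List ℕ → Bool
  | 0, _, _ => true
  | fuel + 1, U, cls =>
    (insertions (sel U cls) (N (sel U cls)) cls).any
        (colorSearch N sel k fuel (U ^^^ (1 <<< (sel U cls).val))) ||
      bif cls.length.blt k then
        colorSearch N sel k fuel (U ^^^ (1 <<< (sel U cls).val)) (N (sel U cls) :: cls)
      else false

/-- Every vertex of the colour `c` lies in the bit set `a`. -/
def Covers {n : ℕ} {α : Type*} (C : Fin n → α) (a : ℕ) (c : α) : Prop :=
  ∀ u, C u = c → a.testBit u = true

lemma exists_mem_insertions {n : ℕ} {α : Type*} {C : Fin n → α} {v : Fin n} {m : ℕ}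
    (hm : Covers C m (C v)) {cls : List ℕ} {L : List α}
    (h : List.Forall₂ (Covers C) cls L) (hv : C v ∈ L) :
    ∃ cls' ∈ insertions v m cls, List.Forall₂ (Covers C) cls' L := by
  induction h with
  | nil => simp at hv
  | @cons a c cls L hac hcls ih =>
    by_cases hc : C v = c
    · subst hc
      refine ⟨(a &&& m) :: cls, ?_, .cons (fun u hu => ?_) hcls⟩
      · simp [insertions, hac v rfl]
      · simp [hac u hu, hm u hu]
    · obtain ⟨cls', hmem, h'⟩ := ih ((List.mem_cons.mp hv).resolve_left hc)
      refine ⟨a :: cls', ?_, .cons hac h'⟩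
      cases hb : a.testBit v <;> simp [insertions, hb, hmem]

lemma colorSearch_eq_true {n k : ℕ} {C : Fin n → Fin k} {N : Fin n → ℕ}
    (hN : ∀ v, Covers C (N v) (C v)) (sel : ℕ → List ℕ → Fin n) (fuel U : ℕ)
    {cls : List ℕ} {L : List (Fin k)} (h : List.Forall₂ (Covers C) cls L) (hL : L.Nodup) :
    colorSearch N sel k fuel U cls = true := by
  induction fuel generalizing U cls L with
  | zero => rfl
  | succ fuel ih =>
    rw [colorSearch, Bool.or_eq_true]
    by_cases hv : C (sel U cls) ∈ L
    · obtain ⟨cls', hmem, h'⟩ := exists_mem_insertions (hN _) h hv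
      exact .inl (List.any_eq_true.mpr ⟨cls', hmem, ih _ h' hL⟩)
    · have hL' : (C (sel U cls) :: L).Nodup := List.nodup_cons.mpr ⟨hv, hL⟩
      have hlt : cls.length.blt k = true := by
        have := hL'.length_le_card
        simp only [List.length_cons, Fintype.card_fin] at this
        simpa [h.length_eq, Nat.blt_eq] using this
      rw [hlt]
      exact .inr (ih _ (.cons (hN _) h) hL')

lemma not_colorable_of_colorSearch_eq_false {n k : ℕ} {G : SimpleGraph (Fin n)} {N : Fin n → ℕ}
    (hN : ∀ v u, ¬ G.Adj v u → (N v).testBit u = true) {sel : ℕ → List ℕ → Fin n} {fuel U : ℕ}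
    (h : colorSearch N sel k fuel U [] = false) : ¬ G.Colorable k := by
  rintro ⟨C⟩
  have hC : ∀ v, Covers C (N v) (C v) := fun v u hu => hN v u fun hvu => C.valid hvu hu.symm
  simpa [h] using colorSearch_eq_true hC sel fuel U .nil .nil

/-- Given the bit sets `g₁`, `g₂`, `g₃` of the vertices with at least one, two, three available
classes among those already inspected, find an element of `U` with as few available classes as
possible, at most three levels being distinguished. -/
def mostConstrained (U : ℕ) : List ℕ → ℕ → ℕ → ℕ → ℕ
  | [], g₁, g₂, g₃ =>
    bif (U &&& g₁).beq U then
      bif (U &&& g₂).beq U then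
        bif (U &&& g₃).beq U then U.log2 else (U ^^^ (U &&& g₃)).log2
      else (U ^^^ (U &&& g₂)).log2
    else (U ^^^ (U &&& g₁)).log2
  | c :: cs, g₁, g₂, g₃ => mostConstrained U cs (g₁ ||| c) (g₂ ||| (g₁ &&& c)) (g₃ ||| (g₂ &&& c))

/-- Neighbourhoods, as bit sets, in the graph of the 27 lines on a cubic surface, two lines being
adjacent when they meet. In the notation of Schläfli the lines are ordered as
`a₁, …, a₆, b₁, …, b₆, c₁₂, c₁₃, …, c₅₆`. -/
def lineNeighbors : List ℕ :=
  [130944, 1974080, 14823104, 52710848, 88640448, 110168000, 127038, 1970237, 14819387, 52707383,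
    88637487, 110166047, 132120771, 119275845, 81396297, 45483089, 23988321, 117555590, 79798922,
    44131474, 23128226, 68784908, 34952468, 17619236, 9647640, 4897320, 2522160]

/-- The complement of the Schläfli graph: the intersection graph of the 27 lines. -/
def cubicLines : SimpleGraph (Fin 27) where
  Adj u v := (lineNeighbors.getD u 0).testBit v = true
  symm := ⟨by decide +kernel⟩
  loopless := ⟨by decide +kernel⟩

instance : DecidableRel cubicLines.Adj := fun u v =>
  inferInstanceAs (Decidable ((lineNeighbors.getD u 0).testBit v = true))

lemma cubicLines_not_colorable : ¬ cubicLines.Colorable 5 :=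
  not_colorable_of_colorSearch_eq_false
    (N := fun v => (2 ^ 27 - 1) ^^^ lineNeighbors.getD v 0) (fuel := 27) (U := 2 ^ 27 - 1)
    (sel := fun U cls => Fin.ofNat 27 <|
      mostConstrained U cls (bif cls.length.blt 5 then U else 0) 0 0)
    (by decide +kernel) (by decide +kernel)

lemma cubicLines_colorable : cubicLines.Colorable 6 :=
  ⟨Coloring.mk ![0, 0, 0, 0, 0, 0, 1, 1, 1, 1, 1, 1, 2, 2, 2, 2, 2, 3, 3, 3, 3, 4, 4, 4, 5, 5, 5]
    (by decide +kernel)⟩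

set_option synthInstance.maxSize 1000 in
lemma cubicLines_no_edge_add_path : ∀ a b, cubicLines.Adj a b →
    ∀ d, ¬ cubicLines.Adj a d → ¬ cubicLines.Adj b d →
    ∀ c, cubicLines.Adj c d → ¬ cubicLines.Adj a c → ¬ cubicLines.Adj b c →
    ∀ e, cubicLines.Adj d e → ¬ cubicLines.Adj a e → ¬ cubicLines.Adj b e →
    ¬ cubicLines.Adj c e → c = e := by
  decide +kernel

lemma cubicLines_eq_of_common_neighbor : ∀ a b, cubicLines.Adj a b →
    ∀ c, cubicLines.Adj a c → cubicLines.Adj b c →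
    ∀ d, cubicLines.Adj a d → cubicLines.Adj b d → c = d := by
  decide +kernel

/-- There is a finite (P2 ∪ P3, diamond, K4)-free graph with chromatic number
exactly 6; in particular it is also P6-free, so the bound 6 is tight. -/
theorem stmt18 : ∃ (n : ℕ) (G : SimpleGraph (Fin n)),
    IndFree p2p3 G ∧ IndFree diamond G ∧ IndFree K4 G ∧
    IndFree (pathGraph 6) G ∧ G.chromaticNumber = 6 := by
  refine ⟨27, cubicLines, ?_, ?_, ?_, ?_, ?_⟩
  · rintro ⟨f⟩
    refine absurd (f.injective <| cubicLines_no_edge_add_path (f 0) (f 1) ?_ (f 3) ?_ ?_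
      (f 2) ?_ ?_ ?_ (f 4) ?_ ?_ ?_ ?_) (by decide) <;>
      rw [f.map_adj_iff] <;> simp [p2p3]
  · rintro ⟨f⟩
    refine absurd (f.injective <| cubicLines_eq_of_common_neighbor (f 1) (f 3) ?_
      (f 0) ?_ ?_ (f 2) ?_ ?_) (by decide) <;>
      rw [f.map_adj_iff] <;> simp [diamond]
  · rintro ⟨f⟩
    refine absurd (f.injective <| cubicLines_eq_of_common_neighbor (f 1) (f 3) ?_
      (f 0) ?_ ?_ (f 2) ?_ ?_) (by decide) <;>
      rw [f.map_adj_iff] <;> simp [K4]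
  · rintro ⟨f⟩
    refine absurd (f.injective <| cubicLines_no_edge_add_path (f 0) (f 1) ?_ (f 4) ?_ ?_
      (f 3) ?_ ?_ ?_ (f 5) ?_ ?_ ?_ ?_) (by decide) <;>
      rw [f.map_adj_iff] <;> simp [pathGraph_adj]
  · exact chromaticNumber_eq_iff_colorable_not_colorable.mpr
      ⟨cubicLines_colorable, cubicLines_not_colorable⟩
end
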